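/- Characterization of the ambiguity in (int3): Let L be a first-order function such that (∂^μ_A ∂^ν_B + ∂^ν_A ∂^μ_B) L = 0 for all μ,ν ∈ {1,…,n} and A,B ∈ {1,…,N}. Then L is a polynomial in the first-order derivative variables of the form L = Σ_{k=0}^{n} (1/k!) Σ C^{μ_1…μ_k}_{A_1…A_k} ψ^{A_1}_{μ_1} ⋯ ψ^{A_k}_{μ_k}, where the coefficient functions C^{μ_1…μ_k}_{A_1…A_k} are smooth functions of (x^μ, ψ^A) only (independent of the variables ψ^A_μ), completely antisymmetric in the indices μ_1,…,μ_k, and completely antisymmetric in the indices A_1,…,A_k. -/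

import Mathlib

/-!
Characterization of the ambiguity in (int3): a first-order function `L` with
`(∂ᵘ_A ∂ᵛ_B + ∂ᵛ_A ∂ᵘ_B) L = 0` is a polynomial
`L = Σ_{k=0}^{n} (1/k!) Σ C^{μ₁…μ_k}_{A₁…A_k} ψ^{A₁}_{μ₁} ⋯ ψ^{A_k}_{μ_k}`
whose coefficients depend only on `(xᵘ, ψᴬ)` and are completely antisymmetric
in the indices `μ₁,…,μ_k` and in the indices `A₁,…,A_k`.
-/

/-- The first-order jet-type space `J = ℝ^n × ℝ^N × ℝ^{N×n}`. -/
abbrev J (n N : ℕ) : Type :=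
  (Fin n → ℝ) × (Fin N → ℝ) × (Fin N → Fin n → ℝ)

/-- `∂ᵘ_A f`: the partial derivative with respect to the variable `ψᴬ_μ`. -/
noncomputable def pd {n N : ℕ} (A : Fin N) (μ : Fin n) (f : J n N → ℝ) :
    J n N → ℝ :=
  fun p => fderiv ℝ f p (0, 0, Pi.single A (Pi.single μ (1 : ℝ)))

section DirectionalDerivatives

variable {E : Type*} [NormedAddCommGroup E] [NormedSpace ℝ E]

/-- The derivative of `f` in the direction `v`, as a function of the base point. -/
noncomputable def dirDeriv (v : E) (f : E → ℝ) : E → ℝ :=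
  fun p => fderiv ℝ f p v

/-- The iterated directional derivative of `f` along a list of directions. -/
noncomputable def iterDirDeriv (l : List E) (f : E → ℝ) : E → ℝ :=
  l.foldr dirDeriv f

lemma dirDeriv_neg (v : E) (f : E → ℝ) : dirDeriv v (-f) = -dirDeriv v f := by
  funext p
  simp [dirDeriv, fderiv_neg]

lemma iterDirDeriv_neg (l : List E) (f : E → ℝ) :
    iterDirDeriv l (-f) = -iterDirDeriv l f := by
  induction l with
  | nil => rfl
  | cons v l ih =>
    change dirDeriv v (iterDirDeriv l (-f)) = -dirDeriv v (iterDirDeriv l f)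
    rw [ih, dirDeriv_neg]

lemma contDiff_dirDeriv (v : E) {f : E → ℝ} (hf : ContDiff ℝ (⊤ : ℕ∞) f) :
    ContDiff ℝ (⊤ : ℕ∞) (dirDeriv v f) :=
  (hf.fderiv_right (m := (⊤ : ℕ∞)) (by simp)).clm_apply contDiff_const

lemma contDiff_iterDirDeriv (l : List E) {f : E → ℝ} (hf : ContDiff ℝ (⊤ : ℕ∞) f) :
    ContDiff ℝ (⊤ : ℕ∞) (iterDirDeriv l f) := by
  induction l with
  | nil => exact hf
  | cons v l ih => exact contDiff_dirDeriv v ih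

lemma dirDeriv_comm (v w : E) {f : E → ℝ} (hf : ContDiff ℝ (⊤ : ℕ∞) f) :
    dirDeriv v (dirDeriv w f) = dirDeriv w (dirDeriv v f) := by
  have hd : Differentiable ℝ (fderiv ℝ f) :=
    (hf.fderiv_right (m := (⊤ : ℕ∞)) (by simp)).differentiable (by simp)
  have key (a b : E) (p : E) : dirDeriv a (dirDeriv b f) p = fderiv ℝ (fderiv ℝ f) p a b := by
    change fderiv ℝ (fun q => fderiv ℝ f q b) p a = _
    rw [fderiv_clm_apply (hd p) (differentiableAt_const b)]
    simp
  funext p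
  rw [key, key]
  exact (hf.contDiffAt.isSymmSndFDerivAt (by
    rw [minSmoothness_of_isRCLikeNormedField]
    exact WithTop.coe_le_coe.2 le_top)) v w

lemma iterDirDeriv_perm {l l' : List E} (h : l.Perm l') {f : E → ℝ}
    (hf : ContDiff ℝ (⊤ : ℕ∞) f) : iterDirDeriv l f = iterDirDeriv l' f := by
  induction h with
  | nil => rfl
  | cons v _ ih => exact congrArg (dirDeriv v) ih
  | swap v w l => exact dirDeriv_comm w v (contDiff_iterDirDeriv l hf)
  | trans _ _ ih₁ ih₂ => exact ih₁.trans ih₂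

lemma iterDirDeriv_cons_cons (v w : E) (l : List E) {f : E → ℝ}
    (hf : ContDiff ℝ (⊤ : ℕ∞) f) :
    iterDirDeriv (v :: w :: l) f = iterDirDeriv l (dirDeriv v (dirDeriv w f)) := by
  have hp : (v :: w :: l).Perm (l ++ [v, w]) := List.perm_append_comm (l₁ := [v, w])
  rw [iterDirDeriv_perm hp hf]
  simp [iterDirDeriv]

lemma iteratedFDeriv_succ_apply_dirDeriv {f : E → ℝ} (hf : ContDiff ℝ (⊤ : ℕ∞) f) {k : ℕ}
    (m : Fin (k + 1) → E) (p : E) :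
    iteratedFDeriv ℝ (k + 1) f p m =
      dirDeriv (m 0) (fun q => iteratedFDeriv ℝ k f q (Fin.tail m)) p :=
  DifferentiableAt.iteratedFDeriv_succ_apply_left'
    ((hf.differentiable_iteratedFDeriv (by exact mod_cast WithTop.coe_lt_top k)) p)

lemma iteratedFDeriv_eq_iterDirDeriv {f : E → ℝ} (hf : ContDiff ℝ (⊤ : ℕ∞) f) {k : ℕ}
    (m : Fin k → E) (p : E) :
    iteratedFDeriv ℝ k f p m = iterDirDeriv (List.ofFn m) f p := by
  induction k generalizing p with
  | zero => simp [iterDirDeriv]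
  | succ k ih =>
    rw [iteratedFDeriv_succ_apply_dirDeriv hf, List.ofFn_succ]
    change _ = dirDeriv (m 0) (iterDirDeriv (List.ofFn (Fin.tail m)) f) p
    congr 1
    funext q
    exact ih _ q

lemma iteratedFDeriv_perm {f : E → ℝ} (hf : ContDiff ℝ (⊤ : ℕ∞) f) {k : ℕ}
    (m : Fin k → E) (σ : Equiv.Perm (Fin k)) (p : E) :
    iteratedFDeriv ℝ k f p (m ∘ σ) = iteratedFDeriv ℝ k f p m := by
  rw [iteratedFDeriv_eq_iterDirDeriv hf, iteratedFDeriv_eq_iterDirDeriv hf,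
    iterDirDeriv_perm (Equiv.Perm.ofFn_comp_perm σ m) hf]

lemma exists_perm_apply_eq {α : Type*} [DecidableEq α] {a b i j : α} (hab : a ≠ b)
    (hij : i ≠ j) : ∃ σ : Equiv.Perm α, σ a = i ∧ σ b = j := by
  have hne : Equiv.swap a i b ≠ i := fun h =>
    hab ((Equiv.swap a i).injective (by simp [h]))
  refine ⟨Equiv.swap (Equiv.swap a i b) j * Equiv.swap a i, ?_, ?_⟩
  · simp [Equiv.swap_apply_of_ne_of_ne hne.symm hij]
  · simp

/-- If two families of directions agree away from `i ≠ j`, and the second derivatives along the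
`i`-th and `j`-th directions are opposite, then so are the iterated derivatives. -/
lemma iteratedFDeriv_eq_neg {f : E → ℝ} (hf : ContDiff ℝ (⊤ : ℕ∞) f) {k : ℕ}
    {m m' : Fin k → E} {i j : Fin k} (hij : i ≠ j)
    (hne : ∀ l, l ≠ i → l ≠ j → m l = m' l)
    (h : dirDeriv (m i) (dirDeriv (m j) f) = -dirDeriv (m' i) (dirDeriv (m' j) f)) (p : E) :
    iteratedFDeriv ℝ k f p m = -iteratedFDeriv ℝ k f p m' := by
  obtain _ | _ | k := k
  · exact i.elim0
  · exact absurd (Fin.ext (by omega)) hij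
  obtain ⟨σ, h0, h1⟩ := exists_perm_apply_eq (a := (0 : Fin (k + 2))) (b := Fin.succ 0)
    (Fin.succ_ne_zero 0).symm hij
  rw [← iteratedFDeriv_perm hf m σ, ← iteratedFDeriv_perm hf m' σ,
    iteratedFDeriv_eq_iterDirDeriv hf, iteratedFDeriv_eq_iterDirDeriv hf]
  have htail : (fun l : Fin k => (m ∘ σ) l.succ.succ) = fun l => (m' ∘ σ) l.succ.succ := by
    funext l
    refine hne _ ?_ ?_
    · rw [← h0]
      exact σ.injective.ne (Fin.succ_ne_zero _)
    · rw [← h1]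
      exact σ.injective.ne fun h => Fin.succ_ne_zero l (Fin.succ_injective _ h)
  rw [List.ofFn_succ, List.ofFn_succ, List.ofFn_succ (f := m' ∘ σ), List.ofFn_succ, htail,
    iterDirDeriv_cons_cons _ _ _ hf, iterDirDeriv_cons_cons _ _ _ hf]
  simp only [Function.comp_apply, h0, h1, h, iterDirDeriv_neg, Pi.neg_apply]

lemma iteratedDeriv_comp_line {f : E → ℝ} (hf : ContDiff ℝ (⊤ : ℕ∞) f) (p v : E) (k : ℕ) :
    iteratedDeriv k (fun t : ℝ => f (p + t • v)) =
      fun t => iteratedFDeriv ℝ k f (p + t • v) (fun _ => v) := by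
  induction k with
  | zero => funext t; simp
  | succ k ih =>
    rw [iteratedDeriv_succ, ih]
    funext t
    rw [iteratedFDeriv_succ_apply_dirDeriv hf]
    have hline : HasDerivAt (fun t : ℝ => p + t • v) v t := by
      simpa using ((hasDerivAt_id t).smul_const v).const_add p
    have hd : Differentiable ℝ (fun q => iteratedFDeriv ℝ k f q (fun _ : Fin k => v)) := by
      have : (fun q => iteratedFDeriv ℝ k f q (fun _ : Fin k => v)) =
          iterDirDeriv (List.ofFn fun _ : Fin k => v) f :=
        funext fun q => iteratedFDeriv_eq_iterDirDeriv hf _ q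
      rw [this]
      exact (contDiff_iterDirDeriv _ hf).differentiable (by simp)
    exact ((hd _).hasFDerivAt.comp_hasDerivAt t hline).deriv

/-- A smooth function whose `(n + 1)`-st derivative vanishes equals its Taylor polynomial. -/
lemma eq_taylor_sum_of_iteratedFDeriv_eq_zero {f : E → ℝ} (hf : ContDiff ℝ (⊤ : ℕ∞) f)
    (p v : E) (n : ℕ) (hz : ∀ q, iteratedFDeriv ℝ (n + 1) f q (fun _ => v) = 0) :
    f (p + v) = ∑ k ∈ Finset.range (n + 1),
      (1 / (Nat.factorial k : ℝ)) * iteratedFDeriv ℝ k f p (fun _ => v) := by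
  set g : ℝ → ℝ := fun t => f (p + t • v) with hg_def
  have hg : ContDiff ℝ (⊤ : ℕ∞) g := hf.comp (by fun_prop)
  obtain ⟨x, -, hx⟩ := taylor_mean_remainder_lagrange_iteratedDeriv (f := g) (n := n)
    (zero_ne_one (α := ℝ)) (hg.of_le (by exact mod_cast le_top)).contDiffOn
  simp only [hg_def, iteratedDeriv_comp_line hf, hz] at hx
  rw [zero_mul, zero_div, sub_eq_zero, ← hg_def, taylor_within_apply] at hx
  have h1 : g 1 = f (p + v) := by simp [hg_def]
  rw [← h1]
  refine hx.trans (Finset.sum_congr rfl fun k _ => ?_)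
  rw [iteratedDerivWithin_eq_iteratedDeriv (uniqueDiffOn_uIcc zero_ne_one)
    (hg.of_le (by exact mod_cast le_top)).contDiffAt Set.left_mem_uIcc, hg_def,
    iteratedDeriv_comp_line hf]
  simp

end DirectionalDerivatives

lemma apply_comp_perm_eq_sign_mul {ι M : Type*} [Fintype ι] [DecidableEq ι]
    {F : (ι → M) → ℝ} (hF : ∀ m i j, i ≠ j → F (m ∘ Equiv.swap i j) = -F m)
    (σ : Equiv.Perm ι) (m : ι → M) :
    F (m ∘ σ) = ((Equiv.Perm.sign σ : ℤ) : ℝ) * F m := by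
  induction σ using Equiv.Perm.swap_induction_on generalizing m with
  | one => simp
  | swap_mul f i j hij ih =>
    rw [Equiv.Perm.coe_mul, ← Function.comp_assoc, ih, hF m i j hij]
    simp [Equiv.Perm.sign_swap hij]

/-- The coordinate direction of `ψᴬ_μ` in the jet space. -/
def jetBasis {n N : ℕ} (A : Fin N) (μ : Fin n) : J n N :=
  (0, 0, Pi.single A (Pi.single μ (1 : ℝ)))

lemma jet_vertical_eq_sum {n N : ℕ} (w : Fin N → Fin n → ℝ) :
    ((0, 0, w) : J n N) = ∑ x : Fin n × Fin N, w x.2 x.1 • jetBasis x.2 x.1 := by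
  refine Prod.ext ?_ (Prod.ext ?_ ?_)
  · simp [jetBasis, Prod.fst_sum]
  · simp [jetBasis, Prod.snd_sum, Prod.fst_sum]
  · funext A μ
    simp only [jetBasis, Prod.snd_sum, Prod.smul_snd, Finset.sum_apply, Pi.smul_apply,
      smul_eq_mul]
    rw [Finset.sum_eq_single (μ, A)]
    · simp
    · rintro ⟨ν, B⟩ - hne
      by_cases hB : A = B
      · subst hB
        have : μ ≠ ν := fun h => hne (by rw [h])
        simp [this]
      · simp [hB]
    · simp

lemma iteratedFDeriv_vertical_eq_sum {n N : ℕ} (L : J n N → ℝ) (k : ℕ) (p : J n N)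
    (w : Fin N → Fin n → ℝ) :
    iteratedFDeriv ℝ k L p (fun _ => (0, 0, w)) =
      ∑ μs : Fin k → Fin n, ∑ As : Fin k → Fin N,
        iteratedFDeriv ℝ k L p (fun i => jetBasis (As i) (μs i)) * ∏ i, w (As i) (μs i) := by
  simp only [jet_vertical_eq_sum w]
  rw [ContinuousMultilinearMap.map_sum, ← Fintype.sum_prod_type',
    ← (Equiv.arrowProdEquivProdArrow (Fin k) (fun _ => Fin n) (fun _ => Fin N)).sum_comp]
  refine Finset.sum_congr rfl fun r _ => ?_
  rw [ContinuousMultilinearMap.map_smul_univ, smul_eq_mul, mul_comm]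
  rfl

lemma iteratedFDeriv_jetBasis_swap {n N : ℕ} {L : J n N → ℝ} (hL : ContDiff ℝ (⊤ : ℕ∞) L)
    (h : ∀ (μ ν : Fin n) (A B : Fin N) (p : J n N),
      pd A μ (pd B ν L) p + pd A ν (pd B μ L) p = 0)
    {k : ℕ} (μs : Fin k → Fin n) (As : Fin k → Fin N)
    {i j : Fin k} (hij : i ≠ j) (p : J n N) :
    iteratedFDeriv ℝ k L p (fun l => jetBasis (As l) ((μs ∘ Equiv.swap i j) l)) =
      -iteratedFDeriv ℝ k L p (fun l => jetBasis (As l) (μs l)) := by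
  refine iteratedFDeriv_eq_neg hL hij (fun l hi hj => ?_) ?_ p
  · simp [Equiv.swap_apply_of_ne_of_ne hi hj]
  · funext q
    simp only [Function.comp_apply, Equiv.swap_apply_left, Equiv.swap_apply_right]
    exact eq_neg_of_add_eq_zero_left (h (μs j) (μs i) (As i) (As j) q)

lemma iteratedFDeriv_jetBasis_comp_left {n N : ℕ} {L : J n N → ℝ} (hL : ContDiff ℝ (⊤ : ℕ∞) L)
    (h : ∀ (μ ν : Fin n) (A B : Fin N) (p : J n N),
      pd A μ (pd B ν L) p + pd A ν (pd B μ L) p = 0)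
    {k : ℕ} (μs : Fin k → Fin n) (As : Fin k → Fin N)
    (σ : Equiv.Perm (Fin k)) (p : J n N) :
    iteratedFDeriv ℝ k L p (fun l => jetBasis (As l) ((μs ∘ σ) l)) =
      ((Equiv.Perm.sign σ : ℤ) : ℝ) *
        iteratedFDeriv ℝ k L p (fun l => jetBasis (As l) (μs l)) :=
  apply_comp_perm_eq_sign_mul
    (F := fun μs : Fin k → Fin n => iteratedFDeriv ℝ k L p (fun l => jetBasis (As l) (μs l)))
    (fun μs _ _ hij => iteratedFDeriv_jetBasis_swap hL h μs As hij p) σ μs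

lemma iteratedFDeriv_jetBasis_comp_right {n N : ℕ} {L : J n N → ℝ} (hL : ContDiff ℝ (⊤ : ℕ∞) L)
    (h : ∀ (μ ν : Fin n) (A B : Fin N) (p : J n N),
      pd A μ (pd B ν L) p + pd A ν (pd B μ L) p = 0)
    {k : ℕ} (μs : Fin k → Fin n) (As : Fin k → Fin N)
    (σ : Equiv.Perm (Fin k)) (p : J n N) :
    iteratedFDeriv ℝ k L p (fun l => jetBasis ((As ∘ σ) l) (μs l)) =
      ((Equiv.Perm.sign σ : ℤ) : ℝ) *
        iteratedFDeriv ℝ k L p (fun l => jetBasis (As l) (μs l)) := by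
  rw [← Equiv.Perm.sign_inv, ← iteratedFDeriv_jetBasis_comp_left hL h μs As σ⁻¹ p,
    ← iteratedFDeriv_perm hL (fun l => jetBasis (As l) ((μs ∘ ⇑σ⁻¹) l)) σ]
  simp [Function.comp_def]

lemma iteratedFDeriv_jetBasis_eq_zero {n N : ℕ} {L : J n N → ℝ} (hL : ContDiff ℝ (⊤ : ℕ∞) L)
    (h : ∀ (μ ν : Fin n) (A B : Fin N) (p : J n N),
      pd A μ (pd B ν L) p + pd A ν (pd B μ L) p = 0)
    {k : ℕ} (hk : n < k) (μs : Fin k → Fin n)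
    (As : Fin k → Fin N) (p : J n N) :
    iteratedFDeriv ℝ k L p (fun l => jetBasis (As l) (μs l)) = 0 := by
  obtain ⟨i, j, hij, hμ⟩ := Fintype.exists_ne_map_eq_of_card_lt μs (by simpa using hk)
  have hs := iteratedFDeriv_jetBasis_swap hL h μs As hij p
  rw [Equiv.comp_swap_eq_update, hμ, Function.update_eq_self, ← hμ,
    Function.update_eq_self] at hs
  linarith

theorem trivial_lagrangian_structure (n N : ℕ) (hn : 0 < n) (hN : 0 < N)
    (L : J n N → ℝ) (hLsmooth : ContDiff ℝ (⊤ : ℕ∞) L)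
    (h : ∀ (μ ν : Fin n) (A B : Fin N) (p : J n N),
      pd A μ (pd B ν L) p + pd A ν (pd B μ L) p = 0) :
    ∃ C : (k : ℕ) → (Fin k → Fin n) → (Fin k → Fin N) →
        ((Fin n → ℝ) × (Fin N → ℝ)) → ℝ,
      (∀ k μs As, ContDiff ℝ (⊤ : ℕ∞) (C k μs As)) ∧
      (∀ (k : ℕ) (μs : Fin k → Fin n) (As : Fin k → Fin N)
          (σ : Equiv.Perm (Fin k)),
        ∀ y, C k (μs ∘ σ) As y = ((Equiv.Perm.sign σ : ℤ) : ℝ) * C k μs As y) ∧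
      (∀ (k : ℕ) (μs : Fin k → Fin n) (As : Fin k → Fin N)
          (σ : Equiv.Perm (Fin k)),
        ∀ y, C k μs (As ∘ σ) y = ((Equiv.Perm.sign σ : ℤ) : ℝ) * C k μs As y) ∧
      (∀ p : J n N,
        L p = ∑ k ∈ Finset.range (n + 1), (1 / (Nat.factorial k : ℝ)) *
          ∑ μs : Fin k → Fin n, ∑ As : Fin k → Fin N,
            C k μs As (p.1, p.2.1) * ∏ i, p.2.2 (As i) (μs i)) := by
  refine ⟨fun k μs As y => iteratedFDeriv ℝ k L (y.1, y.2, 0)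
    (fun l => jetBasis (As l) (μs l)), fun k μs As => ?_,
    fun k μs As σ y => iteratedFDeriv_jetBasis_comp_left hLsmooth h μs As σ _,
    fun k μs As σ y => iteratedFDeriv_jetBasis_comp_right hLsmooth h μs As σ _, fun p => ?_⟩
  · simp only [iteratedFDeriv_eq_iterDirDeriv hLsmooth]
    exact (contDiff_iterDirDeriv _ hLsmooth).comp (by fun_prop)
  · have hT := eq_taylor_sum_of_iteratedFDeriv_eq_zero hLsmooth (p.1, p.2.1, 0) (0, 0, p.2.2) n
      fun q => by
        simp [iteratedFDeriv_vertical_eq_sum,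
          iteratedFDeriv_jetBasis_eq_zero hLsmooth h (Nat.lt_succ_self n)]
    simp only [iteratedFDeriv_vertical_eq_sum] at hT
    simpa using hT
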